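/- Let p : ℝ^n → [1,∞) be measurable with p_+ < ∞. If p(·) satisfies the A_∞ condition, then p(·) satisfies the reverse Hölder condition RH. -/

import Mathlib

open MeasureTheory ENNReal Set

noncomputable section

/-- An axis-parallel cube in `ℝⁿ`, given by its center and (positive) side length. -/
structure RCube (n : ℕ) where
  center : Fin n → ℝ
  side : ℝ
  side_pos : 0 < side

namespace RCube

/-- The (closed) cube as a subset of `ℝⁿ`. -/
def toSet {n : ℕ} (Q : RCube n) : Set (Fin n → ℝ) :=
  {x | ∀ i, |x i - Q.center i| ≤ Q.side / 2}

/-- `rQ`: the cube concentric with `Q` whose side length is `r` times that of `Q`. -/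
def scaledSet {n : ℕ} (Q : RCube n) (r : ℝ) : Set (Fin n → ℝ) :=
  {x | ∀ i, |x i - Q.center i| ≤ r * Q.side / 2}

end RCube

/-- A family of pairwise disjoint cubes. -/
def PairwiseDisjointCubes {n : ℕ} (F : Set (RCube n)) : Prop :=
  F.Pairwise fun Q₁ Q₂ => Disjoint Q₁.toSet Q₂.toSet

/-- The variable Lebesgue norm `‖f‖_{p(·)}` for a real-valued (finite) exponent,
applied to an `ℝ≥0∞`-valued function: `inf {λ > 0 : ∫ (f/λ)^{p(x)} dx ≤ 1}`. -/
def vnorm {n : ℕ} (p : (Fin n → ℝ) → ℝ) (f : (Fin n → ℝ) → ℝ≥0∞) : ℝ≥0∞ :=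
  sInf {lam : ℝ≥0∞ | 0 < lam ∧ (∫⁻ x, (f x / lam) ^ p x) ≤ 1}

/-- `t^e` for `t, e ∈ [0,∞]`, with the standard variable-exponent convention
`t^∞ = 0` for `t ≤ 1` and `t^∞ = ∞` for `t > 1`. -/
def epow (t e : ℝ≥0∞) : ℝ≥0∞ :=
  if e = ∞ then (if t ≤ 1 then 0 else ∞) else t ^ e.toReal

/-- The variable Lebesgue norm for an exponent with values in `[1,∞]`. -/
def vnormE {n : ℕ} (p : (Fin n → ℝ) → ℝ≥0∞) (f : (Fin n → ℝ) → ℝ≥0∞) : ℝ≥0∞ :=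
  sInf {lam : ℝ≥0∞ | 0 < lam ∧ (∫⁻ x, epow (f x / lam) (p x)) ≤ 1}

/-- `|f|` as an `ℝ≥0∞`-valued function. -/
def ofR {n : ℕ} (f : (Fin n → ℝ) → ℝ) : (Fin n → ℝ) → ℝ≥0∞ :=
  fun x => ENNReal.ofReal |f x|

/-- The `ℝ≥0∞`-valued characteristic function of a set. -/
def chiE {n : ℕ} (S : Set (Fin n → ℝ)) : (Fin n → ℝ) → ℝ≥0∞ :=
  S.indicator fun _ => 1

/-- The Hardy--Littlewood maximal operator (over axis-parallel cubes containing `x`). -/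
def hlMaximal {n : ℕ} (f : (Fin n → ℝ) → ℝ) (x : Fin n → ℝ) : ℝ≥0∞ :=
  ⨆ (Q : RCube n) (_ : x ∈ Q.toSet),
    (∫⁻ y in Q.toSet, ENNReal.ofReal |f y|) / volume Q.toSet

/-- `M` is bounded on `L^{p(·)}`: there is `C > 0` with `‖Mf‖_{p(·)} ≤ C ‖f‖_{p(·)}`
for every `f ∈ L^{p(·)}`. -/
def MaximalBounded {n : ℕ} (p : (Fin n → ℝ) → ℝ) : Prop :=
  ∃ C > (0 : ℝ), ∀ f : (Fin n → ℝ) → ℝ, Measurable f → vnorm p (ofR f) < ∞ →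
    vnorm p (hlMaximal f) ≤ ENNReal.ofReal C * vnorm p (ofR f)

/-- The function `∑_{Q ∈ F} t_Q χ_{E_Q}` (for a pairwise disjoint family,
written as a pointwise supremum). -/
def cubeSum {n : ℕ} (F : Set (RCube n)) (t : RCube n → ℝ)
    (E : RCube n → Set (Fin n → ℝ)) (x : Fin n → ℝ) : ℝ≥0∞ :=
  ⨆ (Q : RCube n) (_ : Q ∈ F) (_ : x ∈ E Q), ENNReal.ofReal (t Q)

/-- `p(·)` satisfies the `A_∞` condition with parameter `lam` and constant `C`. -/
def AInftyWith {n : ℕ} (p : (Fin n → ℝ) → ℝ) (lam C : ℝ) : Prop :=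
  ∀ F : Set (RCube n), PairwiseDisjointCubes F →
    ∀ t : RCube n → ℝ, (∀ Q ∈ F, 0 ≤ t Q) →
      ∀ E : RCube n → Set (Fin n → ℝ),
        (∀ Q ∈ F, MeasurableSet (E Q) ∧ E Q ⊆ Q.toSet ∧
          ENNReal.ofReal lam * volume Q.toSet ≤ volume (E Q)) →
        vnorm p (cubeSum F t RCube.toSet) ≤ ENNReal.ofReal C * vnorm p (cubeSum F t E)

/-- The `A_∞` condition for a real-valued exponent. -/
def AInfty {n : ℕ} (p : (Fin n → ℝ) → ℝ) : Prop :=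
  ∃ lam ∈ Ioo (0 : ℝ) 1, ∃ C > (0 : ℝ), AInftyWith p lam C

/-- `p(·)` satisfies the `A_∞` condition with parameter `lam` and constant `C`
(exponent with values in `[1,∞]`). -/
def AInftyWithE {n : ℕ} (p : (Fin n → ℝ) → ℝ≥0∞) (lam C : ℝ) : Prop :=
  ∀ F : Set (RCube n), PairwiseDisjointCubes F →
    ∀ t : RCube n → ℝ, (∀ Q ∈ F, 0 ≤ t Q) →
      ∀ E : RCube n → Set (Fin n → ℝ),
        (∀ Q ∈ F, MeasurableSet (E Q) ∧ E Q ⊆ Q.toSet ∧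
          ENNReal.ofReal lam * volume Q.toSet ≤ volume (E Q)) →
        vnormE p (cubeSum F t RCube.toSet) ≤ ENNReal.ofReal C * vnormE p (cubeSum F t E)

/-- The `A_∞` condition for an exponent with values in `[1,∞]`. -/
def AInftyE {n : ℕ} (p : (Fin n → ℝ) → ℝ≥0∞) : Prop :=
  ∃ lam ∈ Ioo (0 : ℝ) 1, ∃ C > (0 : ℝ), AInftyWithE p lam C

/-- The nonincreasing-rearrangement value `(f χ_Q)^*(s) = inf {α : |{x ∈ Q : |f x| > α}| ≤ s}`. -/
def rearr {n : ℕ} (f : (Fin n → ℝ) → ℝ) (Q : RCube n) (s : ℝ≥0∞) : ℝ≥0∞ :=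
  sInf {a : ℝ≥0∞ | volume {x | x ∈ Q.toSet ∧ a < ENNReal.ofReal |f x|} ≤ s}

/-- The `λ`-median maximal operator `m_λ`. -/
def medianMax {n : ℕ} (lam : ℝ) (f : (Fin n → ℝ) → ℝ) (x : Fin n → ℝ) : ℝ≥0∞ :=
  ⨆ (Q : RCube n) (_ : x ∈ Q.toSet), rearr f Q (ENNReal.ofReal lam * volume Q.toSet)

/-- The modified median maximal operator `m_{τ,r}` (supremum over cubes `Q` with `x ∈ rQ`). -/
def medianMaxR {n : ℕ} (tau r : ℝ) (f : (Fin n → ℝ) → ℝ) (x : Fin n → ℝ) : ℝ≥0∞ :=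
  ⨆ (Q : RCube n) (_ : x ∈ Q.scaledSet r), rearr f Q (ENNReal.ofReal tau * volume Q.toSet)

/-- The average `⟨f⟩_Q = (1/|Q|) ∫_Q f`. -/
def cubeAvg {n : ℕ} (f : (Fin n → ℝ) → ℝ) (Q : RCube n) : ℝ :=
  (∫ y in Q.toSet, f y) / (volume Q.toSet).toReal

/-- `|T_F f|` for a pairwise disjoint family `F`, written as a pointwise supremum. -/
def avgSum {n : ℕ} (F : Set (RCube n)) (f : (Fin n → ℝ) → ℝ) (x : Fin n → ℝ) : ℝ≥0∞ :=
  ⨆ (Q : RCube n) (_ : Q ∈ F) (_ : x ∈ Q.toSet), ENNReal.ofReal |cubeAvg f Q|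

/-- The reverse Hölder condition `RH`. -/
def RHCond {n : ℕ} (p : (Fin n → ℝ) → ℝ) : Prop :=
  ∃ r : ℝ, 1 < r ∧ ∃ C : ℝ, 0 < C ∧
    ∀ S : Set (RCube n), PairwiseDisjointCubes S →
      ∀ t : RCube n → ℝ, (∀ Q ∈ S, 0 ≤ t Q) →
        (∑' Q : S, ∫⁻ x in Q.1.toSet, ENNReal.ofReal (t Q.1) ^ p x) ≤ 1 →
        (∑' Q : S, volume Q.1.toSet *
            ((∫⁻ x in Q.1.toSet, ENNReal.ofReal (t Q.1) ^ (r * p x)) / volume Q.1.toSet)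
              ^ (1 / r)) ≤ ENNReal.ofReal C

namespace RCube

/-- Half-open version of the cube. -/
def half {n : ℕ} (Q : RCube n) : Set (Fin n → ℝ) :=
  {x | ∀ i, Q.center i - Q.side / 2 ≤ x i ∧ x i < Q.center i + Q.side / 2}

lemma half_eq {n : ℕ} (Q : RCube n) : Q.half = Set.univ.pi
    (fun i => Set.Ico (Q.center i - Q.side / 2) (Q.center i + Q.side / 2)) := by
  ext x; simp [half, Set.mem_pi]

lemma toSet_eq {n : ℕ} (Q : RCube n) : Q.toSet = Set.Icc
    (fun i => Q.center i - Q.side / 2) (fun i => Q.center i + Q.side / 2) := by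
  ext x
  simp only [toSet, Set.mem_ofPred_eq, Set.mem_Icc, Pi.le_def, ← forall_and]
  refine forall_congr' fun i => ?_
  rw [abs_le]
  constructor <;> rintro ⟨h1, h2⟩ <;> constructor <;> linarith

lemma toSet_eq_ball {n : ℕ} (Q : RCube n) : Q.toSet = Metric.closedBall Q.center (Q.side / 2) := by
  ext x
  rw [Metric.mem_closedBall, dist_pi_le_iff (by have := Q.side_pos; positivity)]
  simp [toSet, Real.dist_eq]

lemma measurableSet_half {n : ℕ} (Q : RCube n) : MeasurableSet Q.half := by
  rw [half_eq]; exact MeasurableSet.univ_pi fun i => measurableSet_Ico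

lemma measurableSet_toSet {n : ℕ} (Q : RCube n) : MeasurableSet Q.toSet := by
  rw [toSet_eq]; exact measurableSet_Icc

lemma half_ae {n : ℕ} (Q : RCube n) : Q.half =ᵐ[volume] Q.toSet := by
  rw [half_eq, toSet_eq]
  exact Measure.univ_pi_Ico_ae_eq_Icc

lemma half_subset {n : ℕ} (Q : RCube n) : Q.half ⊆ Q.toSet := by
  intro x hx i
  have := hx i
  rw [abs_le]; constructor <;> linarith [this.1, this.2]

lemma volume_toSet {n : ℕ} (Q : RCube n) : volume Q.toSet = ENNReal.ofReal Q.side ^ n := by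
  rw [toSet_eq, Real.volume_Icc_pi]
  simp

lemma volume_half {n : ℕ} (Q : RCube n) : volume Q.half = ENNReal.ofReal Q.side ^ n := by
  rw [measure_congr Q.half_ae, volume_toSet]

lemma volume_half_ne_zero {n : ℕ} (Q : RCube n) : volume Q.half ≠ 0 := by
  rw [volume_half]; exact pow_ne_zero _ (by simpa using Q.side_pos)

lemma volume_half_ne_top {n : ℕ} (Q : RCube n) : volume Q.half ≠ ∞ := by
  rw [volume_half]; exact ENNReal.pow_ne_top ENNReal.ofReal_ne_top

lemma center_mem {n : ℕ} (Q : RCube n) : Q.center ∈ Q.half := by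
  intro i; have := Q.side_pos; constructor <;> linarith

lemma countable_of_half {n : ℕ} (F : Set (RCube n)) (h : F.PairwiseDisjoint half) :
    F.Countable := by
  refine h.countable_of_nonempty_interior fun Q _ => ?_
  refine ⟨Q.center, ?_⟩
  rw [mem_interior_iff_mem_nhds, half_eq]
  refine set_pi_mem_nhds Set.finite_univ fun i _ => ?_
  have := Q.side_pos
  exact Ico_mem_nhds (by linarith) (by linarith)

/-- Closed cube with the same lower corner and side scaled by `θ`. -/
def shr {n : ℕ} (θ : ℝ) (hθ : 0 < θ) (Q : RCube n) : RCube n where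
  center := fun i => Q.center i - Q.side / 2 + θ * Q.side / 2
  side := θ * Q.side
  side_pos := mul_pos hθ Q.side_pos

lemma mem_shr {n : ℕ} {θ : ℝ} {hθ : 0 < θ} {Q : RCube n} {x : Fin n → ℝ} :
    x ∈ (Q.shr θ hθ).toSet ↔ ∀ i, Q.center i - Q.side / 2 ≤ x i ∧
      x i ≤ Q.center i - Q.side / 2 + θ * Q.side := by
  simp only [toSet, shr, Set.mem_ofPred_eq]
  refine forall_congr' fun i => ?_
  rw [abs_le]
  constructor <;> rintro ⟨h1, h2⟩ <;> constructor <;> linarith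

lemma shr_subset {n : ℕ} {θ : ℝ} {hθ : 0 < θ} (h1 : θ < 1) (Q : RCube n) :
    (Q.shr θ hθ).toSet ⊆ Q.half := by
  intro x hx i
  have := mem_shr.1 hx i
  have hs := Q.side_pos
  refine ⟨this.1, ?_⟩
  nlinarith [this.2]

lemma volume_shr {n : ℕ} {θ : ℝ} {hθ : 0 < θ} (Q : RCube n) :
    volume (Q.shr θ hθ).toSet = ENNReal.ofReal (θ ^ n) * volume Q.half := by
  rw [volume_toSet, volume_half, ENNReal.ofReal_pow hθ.le, ← mul_pow,
    ← ENNReal.ofReal_mul hθ.le]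
  rfl

end RCube

lemma rpow_div_le {x c : ℝ≥0∞} {q B : ℝ} (hc0 : c ≠ 0) (hc : c ≤ 1) (hq : 1 ≤ q) (hqB : q ≤ B) :
    (x / c) ^ q ≤ (c ^ B)⁻¹ * x ^ q := by
  rw [ENNReal.div_rpow_of_nonneg _ _ (by linarith), div_eq_mul_inv, mul_comm]
  gcongr ?_ * _
  rw [ENNReal.inv_le_inv]
  exact ENNReal.rpow_le_rpow_of_exponent_ge hc hqB

lemma rpow_mul_le' {x c : ℝ≥0∞} {q : ℝ} (hc : c ≤ 1) (hq : 1 ≤ q) :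
    (c * x) ^ q ≤ c * x ^ q := by
  rw [ENNReal.mul_rpow_of_nonneg _ _ (by linarith)]
  gcongr
  calc c ^ q ≤ c ^ (1:ℝ) := ENNReal.rpow_le_rpow_of_exponent_ge hc hq
    _ = c := by simp

/-- Modular gap form of the `A_∞` condition. -/
lemma gap {n : ℕ} {p : (Fin n → ℝ) → ℝ} (hp1 : ∀ x, 1 ≤ p x) {B : ℝ}
    (hB : ∀ᵐ x ∂(volume : Measure (Fin n → ℝ)), p x ≤ B) {lam C : ℝ} (hC : 0 < C)
    (hA : AInftyWith p lam C) :
    ∃ c : ℝ≥0∞, c ≠ 0 ∧ ∀ F : Set (RCube n), PairwiseDisjointCubes F →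
    ∀ t : RCube n → ℝ, (∀ Q ∈ F, 0 ≤ t Q) →
      ∀ E : RCube n → Set (Fin n → ℝ),
        (∀ Q ∈ F, MeasurableSet (E Q) ∧ E Q ⊆ Q.toSet ∧
          ENNReal.ofReal lam * volume Q.toSet ≤ volume (E Q)) →
        1 / 2 < ∫⁻ x, (cubeSum F t RCube.toSet x) ^ p x →
        c ≤ ∫⁻ x, (cubeSum F t E x) ^ p x := by
  set c0 : ℝ := min 1 (1 / (4 * C)) with hc0
  have hc0pos : 0 < c0 := by positivity
  set d : ℝ≥0∞ := ENNReal.ofReal c0 with hd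
  have hd0 : d ≠ 0 := by simpa [hd] using hc0pos
  have hd1 : d ≤ 1 := by
    rw [hd]; exact ENNReal.ofReal_le_one.2 (min_le_left _ _)
  have hdt : d ≠ ∞ := ENNReal.ofReal_ne_top
  have hdB0 : d ^ B ≠ 0 := by
    simp [ENNReal.rpow_eq_zero_iff, hd0, hdt]
  have hdBt : d ^ B ≠ ∞ := by
    simp [ENNReal.rpow_eq_top_iff, hd0, hdt]
  refine ⟨d ^ B, hdB0, ?_⟩
  intro F hF t ht E hE hlt
  by_contra! hcon
  have h1 : vnorm p (cubeSum F t E) ≤ d := by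
    refine sInf_le ⟨pos_iff_ne_zero.2 hd0, ?_⟩
    calc ∫⁻ x, (cubeSum F t E x / d) ^ p x
        ≤ ∫⁻ x, (d ^ B)⁻¹ * (cubeSum F t E x) ^ p x := by
          refine lintegral_mono_ae ?_
          filter_upwards [hB] with x hx
          exact rpow_div_le hd0 hd1 (hp1 x) hx
      _ = (d ^ B)⁻¹ * ∫⁻ x, (cubeSum F t E x) ^ p x :=
          lintegral_const_mul' _ _ (by simpa using hdB0)
      _ ≤ (d ^ B)⁻¹ * d ^ B := by gcongr
      _ = 1 := ENNReal.inv_mul_cancel hdB0 hdBt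
  have h2 : vnorm p (cubeSum F t RCube.toSet) < 1 / 2 := by
    calc _ ≤ ENNReal.ofReal C * vnorm p (cubeSum F t E) := hA F hF t ht E hE
      _ ≤ ENNReal.ofReal C * d := by gcongr
      _ = ENNReal.ofReal (C * c0) := by rw [hd, ENNReal.ofReal_mul hC.le]
      _ ≤ ENNReal.ofReal (1 / 4) := by
          apply ENNReal.ofReal_le_ofReal
          calc C * c0 ≤ C * (1 / (4 * C)) := by gcongr; exact min_le_right _ _
            _ = 1 / 4 := by field_simp
      _ < ENNReal.ofReal (1 / 2) := by
          rw [ENNReal.ofReal_lt_ofReal_iff] <;> norm_num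
      _ = 1 / 2 := by
          rw [ENNReal.ofReal_div_of_pos] <;> norm_num
  obtain ⟨μ, ⟨hμ0, hμ⟩, hμ2⟩ := sInf_lt_iff.1 h2
  refine absurd hlt (not_lt.2 ?_)
  calc ∫⁻ x, (cubeSum F t RCube.toSet x) ^ p x
      ≤ ∫⁻ x, (1 / 2) * (cubeSum F t RCube.toSet x / μ) ^ p x := by
        refine lintegral_mono fun x => ?_
        refine le_trans ?_ (rpow_mul_le' (by simp) (hp1 x))
        refine ENNReal.rpow_le_rpow ?_ (by linarith [hp1 x])
        have hμt : μ ≠ ∞ := (hμ2.trans_le (by simp)).ne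
        calc cubeSum F t RCube.toSet x = μ * (cubeSum F t RCube.toSet x / μ) :=
              (ENNReal.mul_div_cancel hμ0.ne' hμt).symm
          _ ≤ _ := by gcongr
    _ = (1 / 2) * ∫⁻ x, (cubeSum F t RCube.toSet x / μ) ^ p x :=
          lintegral_const_mul' _ _ (by simp)
    _ ≤ (1 / 2) * 1 := by gcongr
    _ = 1 / 2 := by simp

lemma cubeSum_eq {n : ℕ} (F : Set (RCube n)) (t : RCube n → ℝ)
    (E : RCube n → Set (Fin n → ℝ)) (g : (Fin n → ℝ) → ℝ)
    (h : ∀ Q ∈ F, ∀ x ∈ E Q, t Q = g x) :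
    cubeSum F t E = (⋃ Q ∈ F, E Q).indicator (fun x => ENNReal.ofReal (g x)) := by
  ext x
  unfold cubeSum
  by_cases hx : x ∈ ⋃ Q ∈ F, E Q
  · rw [Set.indicator_of_mem hx]
    obtain ⟨Q, hQ, hxQ⟩ := Set.mem_iUnion₂.1 hx
    apply le_antisymm
    · refine iSup_le fun R => iSup_le fun hR => iSup_le fun hxR => ?_
      rw [h R hR x hxR]
    · rw [← h Q hQ x hxQ]
      exact le_iSup_of_le Q (le_iSup_of_le hQ (le_iSup_of_le hxQ le_rfl))
  · rw [Set.indicator_of_notMem hx]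
    simp only [Set.mem_iUnion, not_exists] at hx
    simp only [ENNReal.iSup_eq_zero]
    intro Q hQ hxQ
    exact absurd hxQ (hx Q hQ)

lemma lintegral_indicator_rpow {n : ℕ} {p : (Fin n → ℝ) → ℝ} (hp1 : ∀ x, 1 ≤ p x)
    {U : Set (Fin n → ℝ)} (hU : MeasurableSet U) (g : (Fin n → ℝ) → ℝ≥0∞) :
    ∫⁻ x, (U.indicator g x) ^ p x = ∫⁻ x in U, g x ^ p x := by
  rw [← lintegral_indicator hU]
  congr 1; ext x
  by_cases hx : x ∈ U
  · simp [hx]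
  · simp [hx, show 0 < p x by linarith [hp1 x]]

/-- Gap lemma for half-open families. -/
lemma gap_half {n : ℕ} {p : (Fin n → ℝ) → ℝ} (hp1 : ∀ x, 1 ≤ p x) {B : ℝ}
    (hB : ∀ᵐ x ∂(volume : Measure (Fin n → ℝ)), p x ≤ B) {lam lam' C : ℝ} (hC : 0 < C)
    (hlam : 0 < lam) (hl : lam < lam')
    (hA : AInftyWith p lam C) :
    ∃ c : ℝ≥0∞, c ≠ 0 ∧ ∀ F : Set (RCube n), F.PairwiseDisjoint RCube.half →
    ∀ τ : (Fin n → ℝ) → ℝ, (∀ x, 0 ≤ τ x) → (∀ Q ∈ F, ∀ x ∈ Q.half, τ x = τ Q.center) →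
      ∀ E : Set (Fin n → ℝ), MeasurableSet E →
        (∀ Q ∈ F, ENNReal.ofReal lam' * volume Q.half ≤ volume (Q.half ∩ E)) →
        1 / 2 < ∫⁻ x in ⋃ Q ∈ F, Q.half, ENNReal.ofReal (τ x) ^ p x →
        c ≤ ∫⁻ x in (⋃ Q ∈ F, Q.half) ∩ E, ENNReal.ofReal (τ x) ^ p x := by
  obtain ⟨c, hc0, hc⟩ := gap hp1 hB hC hA
  refine ⟨c, hc0, ?_⟩
  intro F hF τ hτ0 hτ E hE hFE hlt
  have hFc := RCube.countable_of_half F hF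
  have hθ0 : ∀ j : ℕ, 0 < 1 - 1 / ((j : ℝ) + 2) := by
    intro j
    have : 1 / ((j : ℝ) + 2) < 1 := by
      rw [div_lt_one (by positivity)]; linarith [Nat.cast_nonneg (α := ℝ) j]
    linarith
  have hθ1 : ∀ j : ℕ, 1 - 1 / ((j : ℝ) + 2) < 1 := by
    intro j
    have : 0 < 1 / ((j : ℝ) + 2) := by positivity
    linarith
  set θ : ℕ → ℝ := fun j => 1 - 1 / ((j : ℝ) + 2) with hθ
  have hθlim : Filter.Tendsto θ Filter.atTop (nhds 1) := by
    have h1 : Filter.Tendsto (fun j : ℕ => 1 / ((j : ℝ) + 2)) Filter.atTop (nhds 0) := by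
      have := (tendsto_const_div_atTop_nhds_zero_nat (1 : ℝ)).comp (Filter.tendsto_add_atTop_nat 2)
      refine this.congr fun j => ?_
      simp
    simpa [hθ] using h1.const_sub 1
  have hθmono : Monotone θ := by
    intro i j hij
    simp only [hθ]
    have : (i : ℝ) ≤ j := by exact_mod_cast hij
    gcongr
  set U : ℕ → Set (Fin n → ℝ) := fun j => ⋃ Q ∈ F, (Q.shr (θ j) (hθ0 j)).toSet with hU
  have hUm : ∀ j, MeasurableSet (U j) := fun j =>
    MeasurableSet.biUnion hFc fun Q _ => RCube.measurableSet_toSet _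
  have hUmono : Monotone U := by
    intro i j hij
    refine Set.iUnion₂_mono fun Q _ x hx => ?_
    rw [RCube.mem_shr] at hx ⊢
    intro k
    refine ⟨(hx k).1, (hx k).2.trans ?_⟩
    have := hθmono hij
    have := Q.side_pos
    gcongr
  have hUU : ⋃ j, U j = ⋃ Q ∈ F, Q.half := by
    apply le_antisymm
    · refine Set.iUnion_subset fun j => Set.iUnion₂_mono fun Q _ => RCube.shr_subset (hθ1 j) Q
    · refine Set.iUnion₂_subset fun Q hQ x hx => ?_
      have hs := Q.side_pos
      have : ∀ᶠ j in Filter.atTop, ∀ i, x i < Q.center i - Q.side / 2 + θ j * Q.side := by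
        rw [Filter.eventually_all]
        intro i
        have h1 : Filter.Tendsto (fun j => Q.center i - Q.side / 2 + θ j * Q.side)
            Filter.atTop (nhds (Q.center i - Q.side / 2 + 1 * Q.side)) :=
          (hθlim.mul_const _).const_add _
        refine h1.eventually_const_lt ?_
        linarith [(hx i).2]
      obtain ⟨j, hj⟩ := this.exists
      refine Set.mem_iUnion.2 ⟨j, Set.mem_iUnion₂.2 ⟨Q, hQ, RCube.mem_shr.2 fun i => ?_⟩⟩
      exact ⟨(hx i).1, (hj i).le⟩
  have hsup : ∃ j0, ∀ j ≥ j0, 1 / 2 < ∫⁻ x in U j, ENNReal.ofReal (τ x) ^ p x := by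
    rw [← hUU, setLIntegral_iUnion_of_directed _ (hUmono.directed_le), lt_iSup_iff] at hlt
    obtain ⟨j0, hj0⟩ := hlt
    exact ⟨j0, fun j hj => hj0.trans_le (lintegral_mono_set (hUmono hj))⟩
  obtain ⟨j0, hj0⟩ := hsup
  have hev : ∀ᶠ j in Filter.atTop, 1 - (lam' - lam) < θ j ^ n := by
    refine (hθlim.pow n).eventually_const_lt ?_
    simp; linarith
  obtain ⟨j, hj, hjj⟩ := (hev.and (Filter.eventually_ge_atTop j0)).exists
  have hg := hj0 j hjj
  set sh : RCube n → RCube n := RCube.shr (θ j) (hθ0 j) with hsh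
  have hdis : PairwiseDisjointCubes (sh '' F) := by
    rintro _ ⟨Q, hQ, rfl⟩ _ ⟨R, hR, rfl⟩ hne
    have hQR : Q ≠ R := fun h => hne (by rw [h])
    exact (hF hQ hR hQR).mono (RCube.shr_subset (hθ1 j) Q) (RCube.shr_subset (hθ1 j) R)
  have hcen : ∀ Q ∈ F, ∀ x ∈ (sh Q).toSet, τ (sh Q).center = τ x := by
    intro Q hQ x hx
    have h1 := RCube.shr_subset (hθ1 j) Q hx
    have h2 := RCube.shr_subset (hθ1 j) Q ((sh Q).half_subset (sh Q).center_mem)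
    rw [hτ Q hQ _ h1, hτ Q hQ _ h2]
  have key := hc (sh '' F) hdis (fun R => τ R.center) (fun _ _ => hτ0 _)
    (fun R => R.toSet ∩ E) (by
      rintro _ ⟨Q, hQ, rfl⟩
      refine ⟨(RCube.measurableSet_toSet _).inter hE, Set.inter_subset_left, ?_⟩
      have hv : volume (sh Q).toSet = ENNReal.ofReal (θ j ^ n) * volume Q.half := RCube.volume_shr Q
      have hsub : (sh Q).toSet ⊆ Q.half := RCube.shr_subset (hθ1 j) Q
      have hvle : volume (sh Q).toSet ≤ volume Q.half := measure_mono hsub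
      have hfin := Q.volume_half_ne_top
      have e1 : volume (Q.half ∩ E) ≤ volume ((sh Q).toSet ∩ E) + volume (Q.half \ (sh Q).toSet) := by
        refine (measure_mono ?_).trans (measure_union_le _ _)
        rintro x ⟨hx, hxE⟩
        by_cases h : x ∈ (sh Q).toSet
        · exact Or.inl ⟨h, hxE⟩
        · exact Or.inr ⟨hx, h⟩
      have e2 : volume (Q.half \ (sh Q).toSet) ≤ ENNReal.ofReal (lam' - lam) * volume Q.half := by
        rw [measure_sdiff hsub (RCube.measurableSet_toSet _).nullMeasurableSet
          (ne_top_of_le_ne_top hfin hvle), hv, tsub_le_iff_right, ← add_mul,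
          ← ENNReal.ofReal_add (by linarith) (pow_nonneg (hθ0 j).le _)]
        calc volume Q.half = 1 * volume Q.half := by simp
          _ ≤ _ := by
            gcongr
            rw [ENNReal.one_le_ofReal]; linarith
      have e3 : ENNReal.ofReal lam * volume Q.half +
          ENNReal.ofReal (lam' - lam) * volume Q.half ≤ volume ((sh Q).toSet ∩ E) +
          ENNReal.ofReal (lam' - lam) * volume Q.half := by
        rw [← add_mul, ← ENNReal.ofReal_add hlam.le (by linarith)]
        calc _ = ENNReal.ofReal lam' * volume Q.half := by ring_nf
          _ ≤ _ := hFE Q hQ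
          _ ≤ _ := e1
          _ ≤ _ := by gcongr
      have e4 := (ENNReal.add_le_add_iff_right
        (ENNReal.mul_ne_top ENNReal.ofReal_ne_top hfin)).1 e3
      exact le_trans (by gcongr) e4)
  rw [cubeSum_eq _ _ _ τ (by rintro _ ⟨Q, hQ, rfl⟩ x hx; exact hcen Q hQ x hx),
    cubeSum_eq _ _ _ τ (by rintro _ ⟨Q, hQ, rfl⟩ x hx; exact hcen Q hQ x hx.1),
    Set.biUnion_image, Set.biUnion_image,
    lintegral_indicator_rpow hp1 (hUm j), lintegral_indicator_rpow hp1
      (MeasurableSet.biUnion hFc fun Q _ => (RCube.measurableSet_toSet _).inter hE)] at key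
  refine (key hg).trans (lintegral_mono_set ?_)
  rw [Set.iUnion₂_inter]
  exact Set.iUnion₂_mono fun Q _ => Set.inter_subset_inter_left _ (RCube.shr_subset (hθ1 j) Q)

namespace RCube

/-- Dyadic index of a point relative to `R` at level `m`. -/
def idx {n : ℕ} (R : RCube n) (m : ℕ) (x : Fin n → ℝ) (i : Fin n) : ℤ :=
  ⌊2 ^ m * ((x i - (R.center i - R.side / 2)) / R.side)⌋

/-- Dyadic cell relative to `R` at level `m`. -/
def cell {n : ℕ} (R : RCube n) (m : ℕ) (v : Fin n → ℤ) : RCube n where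
  center := fun i => R.center i - R.side / 2 + ((v i : ℝ) + 1 / 2) * (R.side / 2 ^ m)
  side := R.side / 2 ^ m
  side_pos := div_pos R.side_pos (by positivity)

lemma mem_cell {n : ℕ} {R : RCube n} {m : ℕ} {v : Fin n → ℤ} {x : Fin n → ℝ} :
    x ∈ (R.cell m v).half ↔ R.idx m x = v := by
  rw [funext_iff]
  simp only [half, cell, Set.mem_ofPred_eq, idx]
  refine forall_congr' fun i => ?_
  rw [Int.floor_eq_iff]
  have hs := R.side_pos
  have e : 2 ^ m * ((x i - (R.center i - R.side / 2)) / R.side)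
      = (x i - (R.center i - R.side / 2)) / (R.side / 2 ^ m) := by field_simp
  have hd : 0 < R.side / 2 ^ m := by positivity
  rw [e, le_div_iff₀ hd, div_lt_iff₀ hd]
  constructor <;> rintro ⟨h1, h2⟩ <;> constructor <;> nlinarith

lemma mem_half_iff {n : ℕ} {R : RCube n} {x : Fin n → ℝ} :
    x ∈ R.half ↔ R.idx 0 x = 0 := by
  rw [← mem_cell]
  simp only [half, cell, Set.mem_ofPred_eq]
  refine forall_congr' fun i => ?_
  simp only [Pi.zero_apply, Int.cast_zero, pow_zero, div_one]
  constructor <;> rintro ⟨h1, h2⟩ <;> constructor <;> linarith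

lemma cell_zero_half {n : ℕ} (R : RCube n) : (R.cell 0 0).half = R.half := by
  ext x; rw [mem_cell, mem_half_iff]

lemma idx_succ {n : ℕ} {R : RCube n} {m : ℕ} {x y : Fin n → ℝ}
    (h : R.idx (m + 1) x = R.idx (m + 1) y) : R.idx m x = R.idx m y := by
  have key : ∀ z i, R.idx m z i = R.idx (m + 1) z i / 2 := by
    intro z i
    have := Int.floor_div_natCast (2 ^ (m + 1) * ((z i - (R.center i - R.side / 2)) / R.side)) 2
    simp only [idx]
    rw [show ((2 : ℕ) : ℤ) = 2 by norm_num] at this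
    rw [← this]
    congr 1
    push_cast
    rw [pow_succ]; ring
  ext i
  rw [key, key, h]

lemma idx_le {n : ℕ} {R : RCube n} {m k : ℕ} (hk : k ≤ m) {x y : Fin n → ℝ}
    (h : R.idx m x = R.idx m y) : R.idx k x = R.idx k y := by
  induction m, hk using Nat.le_induction with
  | base => exact h
  | succ m _ ih => exact ih (idx_succ h)

lemma volume_cell_succ {n : ℕ} (R : RCube n) (m : ℕ) (v v' : Fin n → ℤ) :
    volume (R.cell m v).half = 2 ^ n * volume (R.cell (m + 1) v').half := by
  rw [volume_half, volume_half, ← mul_pow]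
  congr 1
  simp only [cell]
  rw [show (2 : ℝ≥0∞) = ENNReal.ofReal 2 by norm_num, ← ENNReal.ofReal_mul (by norm_num)]
  congr 1
  rw [pow_succ]; field_simp

end RCube

/-- Lebesgue differentiation along the dyadic cells. -/
lemma ae_le_of_cells {n : ℕ} (R : RCube n) (w : (Fin n → ℝ) → ℝ≥0∞) (hw : Measurable w)
    (K : ℝ≥0∞) (hfin : ∫⁻ x in R.half, w x ≠ ∞) :
    ∀ᵐ x, x ∈ R.half → (∀ m, ∫⁻ y in (R.cell m (R.idx m x)).half, w y ≤
      K * volume (R.cell m (R.idx m x)).half) → w x ≤ K := by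
  have h := (IsUnifLocDoublingMeasure.vitaliFamily
    (volume : Measure (Fin n → ℝ)) 1).ae_tendsto_lintegral_div
    (f := R.half.indicator w) (hw.indicator R.measurableSet_half).aemeasurable
    (by rwa [lintegral_indicator R.measurableSet_half])
  filter_upwards [h] with x hx hxR hm
  rw [Set.indicator_of_mem hxR] at hx
  have hs := R.side_pos
  have hδ : Filter.Tendsto (fun m : ℕ => (R.cell m (R.idx m x)).side / 2) Filter.atTop
      (nhdsWithin 0 (Set.Ioi 0)) := by
    rw [tendsto_nhdsWithin_iff]
    constructor
    · have := (tendsto_pow_atTop_nhds_zero_of_lt_one (r := (1/2:ℝ)) (by norm_num)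
        (by norm_num)).const_mul (R.side / 2)
      rw [mul_zero] at this
      refine this.congr fun m => ?_
      simp only [RCube.cell]
      rw [one_div, inv_pow]; field_simp
    · refine Filter.Eventually.of_forall fun m => ?_
      have := (R.cell m (R.idx m x)).side_pos
      exact half_pos this
  have ht := hx.comp (IsUnifLocDoublingMeasure.tendsto_closedBall_filterAt
    (volume : Measure (Fin n → ℝ)) (K := 1)
    (fun m => (R.cell m (R.idx m x)).center) _ hδ (by
      refine Filter.Eventually.of_forall fun m => ?_
      rw [one_mul, ← RCube.toSet_eq_ball]
      exact RCube.half_subset _ (RCube.mem_cell.2 rfl)))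
  refine le_of_tendsto' ht fun m => ?_
  simp only [Function.comp]
  rw [← RCube.toSet_eq_ball, ← setLIntegral_congr (RCube.half_ae _),
    ← measure_congr (RCube.half_ae _)]
  refine ENNReal.div_le_of_le_mul (le_trans ?_ (hm m))
  exact lintegral_mono fun y => Set.indicator_le_self _ _ _

/-- One step of the Calderón–Zygmund decomposition. -/
lemma cz_step {n : ℕ} (w : (Fin n → ℝ) → ℝ≥0∞) (hw : Measurable w) (b : ℝ≥0∞) (hb : 1 ≤ b)
    (hbt : b ≠ ∞) (R : RCube n) (A : ℝ≥0∞) (hA0 : A ≠ 0) (hAt : A ≠ ∞)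
    (hR : ∫⁻ x in R.half, w x ≤ A * volume R.half) :
    ∃ G : Set (RCube n), G.PairwiseDisjoint RCube.half ∧
      (∀ P ∈ G, P.half ⊆ R.half) ∧
      (∀ P ∈ G, ∫⁻ x in P.half, w x ≤ (A * (2 ^ n * b)) * volume P.half) ∧
      b * volume (⋃ P ∈ G, P.half) ≤ volume R.half ∧
      (∀ᵐ x, x ∈ R.half → x ∉ (⋃ P ∈ G, P.half) → w x ≤ b * A) := by
  classical
  set bad : ℕ → (Fin n → ℤ) → Prop := fun m v =>
    b * A * volume (R.cell m v).half < ∫⁻ x in (R.cell m v).half, w x with hbad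
  have hfin : ∫⁻ x in R.half, w x ≠ ∞ :=
    ne_top_of_le_ne_top (ENNReal.mul_ne_top hAt R.volume_half_ne_top) hR
  have hbad0 : ¬ bad 0 0 := by
    simp only [hbad, not_lt, R.cell_zero_half]
    refine hR.trans ?_
    gcongr
    exact le_mul_of_one_le_left' hb
  set G : Set (RCube n) := {P | ∃ m, ∃ x ∈ R.half, P = R.cell m (R.idx m x) ∧
    bad m (R.idx m x) ∧ ∀ k < m, ¬ bad k (R.idx k x)} with hG
  have hGd : G.PairwiseDisjoint RCube.half := by
    rintro _ ⟨m, x, hx, rfl, hbx, hx'⟩ _ ⟨m', x', hxx', rfl, hbx', hx''⟩ hne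
    rw [Function.onFun, Set.disjoint_left]
    intro y hy hy'
    rw [RCube.mem_cell] at hy hy'
    rcases lt_trichotomy m m' with h | h | h
    · have := RCube.idx_le h.le hy'
      exact hx'' m h (by rw [← this, hy]; exact hbx)
    · subst h
      exact hne (by rw [← hy, ← hy'])
    · have := RCube.idx_le h.le hy
      exact hx' m' h (by rw [← this, hy']; exact hbx')
  have hGc := RCube.countable_of_half G hGd
  have hGs : ∀ P ∈ G, P.half ⊆ R.half := by
    rintro _ ⟨m, x, hx, rfl, -, -⟩ y hy
    rw [RCube.mem_cell] at hy
    rw [RCube.mem_half_iff] at hx ⊢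
    rw [RCube.idx_le (Nat.zero_le m) hy, hx]
  refine ⟨G, hGd, hGs, ?_, ?_, ?_⟩
  · rintro _ ⟨m, x, hx, rfl, hbx, hx'⟩
    cases m with
    | zero => rw [RCube.mem_half_iff.1 hx] at hbx; exact absurd hbx hbad0
    | succ m =>
      have h1 := hx' m (Nat.lt_succ_self m)
      simp only [hbad, not_lt] at h1
      calc ∫⁻ y in (R.cell (m + 1) (R.idx (m + 1) x)).half, w y
          ≤ ∫⁻ y in (R.cell m (R.idx m x)).half, w y := by
            refine lintegral_mono_set fun y hy => ?_
            rw [RCube.mem_cell] at hy ⊢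
            exact RCube.idx_succ hy
        _ ≤ _ := h1
        _ = _ := by rw [R.volume_cell_succ m _ (R.idx (m + 1) x)]; ring
  · have h1 : b * A * volume (⋃ P ∈ G, P.half) ≤ A * volume R.half := by
      rw [measure_biUnion hGc hGd fun P _ => P.measurableSet_half, ← ENNReal.tsum_mul_left]
      calc ∑' P : G, b * A * volume P.1.half ≤ ∑' P : G, ∫⁻ x in P.1.half, w x := by
            refine ENNReal.tsum_le_tsum ?_
            rintro ⟨_, ⟨m, x, hx, rfl, hbx, -⟩⟩
            exact hbx.le
        _ = ∫⁻ x in ⋃ P ∈ G, P.half, w x :=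
            (lintegral_biUnion hGc (fun P _ => P.measurableSet_half) hGd _).symm
        _ ≤ ∫⁻ x in R.half, w x := lintegral_mono_set (Set.iUnion₂_subset hGs)
        _ ≤ _ := hR
    rw [mul_comm b A, mul_assoc] at h1
    exact (ENNReal.mul_le_mul_iff_right hA0 hAt).1 h1
  · filter_upwards [ae_le_of_cells R w hw (b * A) hfin] with x hx hxR hxG
    refine hx hxR fun m => ?_
    by_contra! hcon
    have hex : ∃ m, bad m (R.idx m x) := ⟨m, hcon⟩
    refine hxG (Set.mem_iUnion₂.2 ⟨R.cell (Nat.find hex) (R.idx (Nat.find hex) x),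
      ⟨Nat.find hex, x, hxR, rfl, Nat.find_spec hex, fun k hk => Nat.find_min hex hk⟩,
      RCube.mem_cell.2 rfl⟩)

/-- Iterated Calderón–Zygmund decomposition. -/
lemma cz_iter {n : ℕ} (w : (Fin n → ℝ) → ℝ≥0∞) (hw : Measurable w) (b : ℝ≥0∞) (hb : 1 ≤ b)
    (hbt : b ≠ ∞) (Q : RCube n) (A : ℝ≥0∞) (hA0 : A ≠ 0) (hAt : A ≠ ∞)
    (hQ : ∫⁻ x in Q.half, w x ≤ A * volume Q.half) :
    ∃ F : ℕ → Set (RCube n), F 0 = {Q} ∧ (∀ k, (F k).PairwiseDisjoint RCube.half) ∧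
      (∀ k, (⋃ P ∈ F (k + 1), P.half) ⊆ ⋃ P ∈ F k, P.half) ∧
      (∀ k, ∀ R ∈ F k, b * volume (R.half ∩ ⋃ P ∈ F (k + 1), P.half) ≤ volume R.half) ∧
      (∀ᵐ x, ∀ k, x ∈ (⋃ P ∈ F k, P.half) → x ∉ (⋃ P ∈ F (k + 1), P.half) →
        w x ≤ A * (2 ^ n * b) ^ (k + 1)) := by
  have h2b : (1 : ℝ≥0∞) ≤ 2 ^ n := one_le_pow₀ (by norm_num)
  have ha0 : (2 ^ n * b : ℝ≥0∞) ≠ 0 :=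
    mul_ne_zero (by positivity) (by positivity)
  have hat : (2 ^ n * b : ℝ≥0∞) ≠ ∞ := ENNReal.mul_ne_top (by simp) hbt
  have hstep : ∀ (k : ℕ) (R : RCube n), ∃ G : Set (RCube n),
      ∫⁻ x in R.half, w x ≤ A * (2 ^ n * b) ^ k * volume R.half →
      G.PairwiseDisjoint RCube.half ∧
      (∀ P ∈ G, P.half ⊆ R.half) ∧
      (∀ P ∈ G, ∫⁻ x in P.half, w x ≤ (A * (2 ^ n * b) ^ k * (2 ^ n * b)) * volume P.half) ∧
      b * volume (⋃ P ∈ G, P.half) ≤ volume R.half ∧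
      (∀ᵐ x, x ∈ R.half → x ∉ (⋃ P ∈ G, P.half) → w x ≤ b * (A * (2 ^ n * b) ^ k)) := by
    intro k R
    by_cases h : ∫⁻ x in R.half, w x ≤ A * (2 ^ n * b) ^ k * volume R.half
    · obtain ⟨G, hG⟩ := cz_step w hw b hb hbt R (A * (2 ^ n * b) ^ k)
        (mul_ne_zero hA0 (pow_ne_zero _ ha0)) (ENNReal.mul_ne_top hAt (ENNReal.pow_ne_top hat)) h
      exact ⟨G, fun _ => hG⟩
    · exact ⟨∅, fun h' => absurd h' h⟩
  choose G hG using hstep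
  set F : ℕ → Set (RCube n) := fun k => Nat.rec {Q} (fun k Fk => ⋃ R ∈ Fk, G k R) k with hF
  have hF0 : F 0 = {Q} := rfl
  have hFs : ∀ k, F (k + 1) = ⋃ R ∈ F k, G k R := fun k => rfl
  have hbound : ∀ k, ∀ R ∈ F k, ∫⁻ x in R.half, w x ≤ A * (2 ^ n * b) ^ k * volume R.half := by
    intro k
    induction k with
    | zero => intro R hR; rw [hF0, Set.mem_singleton_iff] at hR; subst hR; simpa using hQ
    | succ k ih =>
      intro P hP
      rw [hFs] at hP
      obtain ⟨R, hR, hPR⟩ := Set.mem_iUnion₂.1 hP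
      have := (hG k R (ih R hR)).2.2.1 P hPR
      rwa [pow_succ, ← mul_assoc]
  have hd : ∀ k, (F k).PairwiseDisjoint RCube.half := by
    intro k
    induction k with
    | zero => rw [hF0]; exact Set.pairwiseDisjoint_singleton _ _
    | succ k ih =>
      intro P hP P' hP' hne
      rw [hFs] at hP hP'
      obtain ⟨R, hR, hPR⟩ := Set.mem_iUnion₂.1 hP
      obtain ⟨R', hR', hPR'⟩ := Set.mem_iUnion₂.1 hP'
      by_cases hRR : R = R'
      · subst hRR
        exact (hG k R (hbound k R hR)).1 hPR hPR' hne
      · exact (ih hR hR' hRR).mono ((hG k R (hbound k R hR)).2.1 P hPR)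
          ((hG k R' (hbound k R' hR')).2.1 P' hPR')
  have hinter : ∀ k, ∀ R ∈ F k, R.half ∩ (⋃ P ∈ F (k + 1), P.half) ⊆ ⋃ P ∈ G k R, P.half := by
    rintro k R hR x ⟨hxR, hx⟩
    obtain ⟨P, hP, hxP⟩ := Set.mem_iUnion₂.1 hx
    rw [hFs] at hP
    obtain ⟨R', hR', hPR'⟩ := Set.mem_iUnion₂.1 hP
    have hxR' := (hG k R' (hbound k R' hR')).2.1 P hPR' hxP
    have : R = R' := by
      by_contra hne
      exact Set.disjoint_left.1 (hd k hR hR' hne) hxR hxR'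
    subst this
    exact Set.mem_iUnion₂.2 ⟨P, hPR', hxP⟩
  refine ⟨F, hF0, hd, ?_, ?_, ?_⟩
  · intro k
    refine Set.iUnion₂_subset fun P hP => ?_
    rw [hFs] at hP
    obtain ⟨R, hR, hPR⟩ := Set.mem_iUnion₂.1 hP
    exact ((hG k R (hbound k R hR)).2.1 P hPR).trans
      (Set.subset_biUnion_of_mem (u := fun R : RCube n => R.half) hR)
  · intro k R hR
    exact le_trans (by gcongr; exact hinter k R hR) (hG k R (hbound k R hR)).2.2.2.1
  · rw [ae_all_iff]
    intro k
    have h1 : ∀ᵐ x, ∀ R ∈ F k, x ∈ R.half → x ∉ (⋃ P ∈ G k R, P.half) →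
        w x ≤ b * (A * (2 ^ n * b) ^ k) := by
      rw [ae_ball_iff (RCube.countable_of_half _ (hd k))]
      intro R hR
      exact (hG k R (hbound k R hR)).2.2.2.2
    filter_upwards [h1] with x hx hxk hxk1
    obtain ⟨R, hR, hxR⟩ := Set.mem_iUnion₂.1 hxk
    refine (hx R hR hxR ?_).trans ?_
    · intro hxG
      obtain ⟨P, hP, hxP⟩ := Set.mem_iUnion₂.1 hxG
      refine hxk1 (Set.mem_iUnion₂.2 ⟨P, ?_, hxP⟩)
      rw [hFs]
      exact Set.mem_iUnion₂.2 ⟨R, hR, hP⟩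
    · rw [pow_succ]
      calc b * (A * (2 ^ n * b) ^ k) = A * ((2 ^ n * b) ^ k * (1 * b)) := by ring
        _ ≤ _ := by gcongr

lemma rh_arith {V A X Y : ℝ≥0∞} {ε : ℝ} (hε : 0 < ε) (hV0 : V ≠ 0) (hVt : V ≠ ∞)
    (hY : Y ≤ A ^ ε * X) : V * (Y / V) ^ (1 / (1 + ε)) ≤ A * V + X := by
  set M := A * V + X with hM
  have h1 : A ≤ M / V := by
    rw [ENNReal.le_div_iff_mul_le (Or.inl hV0) (Or.inl hVt)]
    exact le_self_add
  have h2 : X ≤ M := le_add_self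
  have h3 : Y / V ≤ (M / V) ^ (1 + ε) := by
    rw [add_comm, ENNReal.rpow_add_of_nonneg _ _ hε.le zero_le_one, ENNReal.rpow_one]
    calc Y / V ≤ (A ^ ε * X) / V := by gcongr
      _ = A ^ ε * (X / V) := by rw [mul_div_assoc]
      _ ≤ _ := by gcongr
  calc V * (Y / V) ^ (1 / (1 + ε)) ≤ V * ((M / V) ^ (1 + ε)) ^ (1 / (1 + ε)) := by gcongr
    _ = V * (M / V) := by
      rw [← ENNReal.rpow_mul, mul_one_div_cancel (by linarith), ENNReal.rpow_one]
    _ = M := ENNReal.mul_div_cancel hV0 hVt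

/-- Decomposition of one cube with the resulting reverse Hölder bound. -/
lemma cz_rh {n : ℕ} (w : (Fin n → ℝ) → ℝ≥0∞) (hw : Measurable w) (b : ℝ≥0∞) (hb : 1 ≤ b)
    (hbt : b ≠ ∞) {ε : ℝ} (hε : 0 < ε) (Q : RCube n) (hfin : ∫⁻ x in Q.half, w x ≠ ∞) :
    ∃ F : ℕ → Set (RCube n), F 0 = {Q} ∧ (∀ k, (F k).PairwiseDisjoint RCube.half) ∧
      (∀ k, (⋃ P ∈ F (k + 1), P.half) ⊆ ⋃ P ∈ F k, P.half) ∧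
      (∀ k, ∀ R ∈ F k, b * volume (R.half ∩ ⋃ P ∈ F (k + 1), P.half) ≤ volume R.half) ∧
      volume Q.half * ((∫⁻ x in Q.half, w x ^ (1 + ε)) / volume Q.half) ^ (1 / (1 + ε)) ≤
        (∫⁻ x in Q.half, w x) + ∑' k : ℕ, ((2 ^ n * b) ^ (k + 1)) ^ ε *
          ∫⁻ x in ⋃ P ∈ F k, P.half, w x := by
  have hV0 := Q.volume_half_ne_zero
  have hVt := Q.volume_half_ne_top
  by_cases hz : ∫⁻ x in Q.half, w x = 0
  · obtain ⟨F, h0, h1, h2, h3, -⟩ := cz_iter w hw b hb hbt Q 1 one_ne_zero ENNReal.one_ne_top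
      (by rw [hz]; exact zero_le)
    refine ⟨F, h0, h1, h2, h3, ?_⟩
    have : ∫⁻ x in Q.half, w x ^ (1 + ε) = 0 := by
      rw [lintegral_eq_zero_iff hw] at hz
      rw [lintegral_eq_zero_iff (hw.pow_const _)]
      filter_upwards [hz] with x hx
      simp only [Pi.zero_apply] at hx ⊢
      rw [hx, ENNReal.zero_rpow_of_pos (by linarith)]
    rw [this, ENNReal.zero_div, ENNReal.zero_rpow_of_pos (by positivity), mul_zero]
    exact zero_le
  · set A := (∫⁻ x in Q.half, w x) / volume Q.half with hA
    have hA0 : A ≠ 0 := by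
      rw [hA]; exact (ENNReal.div_pos hz hVt).ne'
    have hAt : A ≠ ∞ := ENNReal.div_ne_top hfin hV0
    have hAV : A * volume Q.half = ∫⁻ x in Q.half, w x := ENNReal.div_mul_cancel hV0 hVt
    obtain ⟨F, h0, h1, h2, h3, h4⟩ := cz_iter w hw b hb hbt Q A hA0 hAt hAV.ge
    refine ⟨F, h0, h1, h2, h3, ?_⟩
    rw [← hAV]
    refine rh_arith hε hV0 hVt ?_
    have ha1 : (1 : ℝ≥0∞) ≤ 2 ^ n * b := by
      calc (1 : ℝ≥0∞) = 1 * 1 := by simp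
        _ ≤ _ := by gcongr; exact one_le_pow₀ (by norm_num)
    set Ω : ℕ → Set (Fin n → ℝ) := fun k => ⋃ P ∈ F k, P.half with hΩ
    have hΩm : ∀ k, MeasurableSet (Ω k) := fun k =>
      MeasurableSet.biUnion (RCube.countable_of_half _ (h1 k)) fun P _ => P.measurableSet_half
    have hΩ0 : Ω 0 = Q.half := by simp [hΩ, h0]
    have hpt : ∀ᵐ x, x ∈ Q.half → w x ^ (1 + ε) ≤
        A ^ ε * ∑' k : ℕ, ((2 ^ n * b) ^ (k + 1)) ^ ε * (Ω k).indicator w x := by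
      filter_upwards [h4] with x hx hxQ
      by_cases hwx : w x = 0
      · rw [hwx, ENNReal.zero_rpow_of_pos (by linarith)]; exact zero_le
      by_cases hex : ∃ k, x ∉ Ω k
      · classical
        obtain ⟨j, hj⟩ : ∃ j, Nat.find hex = j + 1 := by
          refine Nat.exists_eq_succ_of_ne_zero fun h => ?_
          have := Nat.find_spec hex
          rw [h, hΩ0] at this
          exact this hxQ
        have hj1 : x ∉ Ω (j + 1) := by rw [← hj]; exact Nat.find_spec hex
        have hj0 : x ∈ Ω j := by
          have := Nat.find_min hex (m := j) (by omega)
          exact not_not.1 this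
        have hle := hx j hj0 hj1
        calc w x ^ (1 + ε) = w x ^ ε * w x := by
              rw [add_comm, ENNReal.rpow_add_of_nonneg _ _ hε.le zero_le_one, ENNReal.rpow_one]
          _ ≤ (A * (2 ^ n * b) ^ (j + 1)) ^ ε * w x := by gcongr
          _ = A ^ ε * (((2 ^ n * b) ^ (j + 1)) ^ ε * (Ω j).indicator w x) := by
              rw [ENNReal.mul_rpow_of_nonneg _ _ hε.le, Set.indicator_of_mem hj0, mul_assoc]
          _ ≤ _ := by
              gcongr
              exact ENNReal.le_tsum (f := fun k : ℕ => ((2 ^ n * b) ^ (k + 1)) ^ ε *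
                (Ω k).indicator w x) j
      · push Not at hex
        have htop : ∑' k : ℕ, ((2 ^ n * b) ^ (k + 1)) ^ ε * (Ω k).indicator w x = ∞ := by
          rw [eq_top_iff]
          calc ∞ = ∑' _ : ℕ, w x := (ENNReal.tsum_const_eq_top_of_ne_zero hwx).symm
            _ ≤ _ := by
              refine ENNReal.tsum_le_tsum fun k => ?_
              rw [Set.indicator_of_mem (hex k)]
              refine le_mul_of_one_le_left' ?_
              exact ENNReal.one_le_rpow (one_le_pow₀ ha1) hε
        rw [htop, ENNReal.mul_top]
        · exact le_top
        · simp [ENNReal.rpow_eq_zero_iff, hA0, hAt]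
    calc ∫⁻ x in Q.half, w x ^ (1 + ε)
        ≤ ∫⁻ x in Q.half, A ^ ε * ∑' k : ℕ, ((2 ^ n * b) ^ (k + 1)) ^ ε *
            (Ω k).indicator w x := by
          refine lintegral_mono_ae ?_
          exact (ae_restrict_iff' Q.measurableSet_half).2 hpt
      _ ≤ ∫⁻ x, A ^ ε * ∑' k : ℕ, ((2 ^ n * b) ^ (k + 1)) ^ ε *
            (Ω k).indicator w x := setLIntegral_le_lintegral _ _
      _ = A ^ ε * ∑' k : ℕ, ((2 ^ n * b) ^ (k + 1)) ^ ε * ∫⁻ x in Ω k, w x := by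
          have hm : ∀ k : ℕ, Measurable fun x =>
              (((2 ^ n * b) ^ (k + 1)) ^ ε * (Ω k).indicator w x : ℝ≥0∞) := fun k =>
            (hw.indicator (hΩm k)).const_mul _
          rw [lintegral_const_mul _ (Measurable.ennreal_tsum hm),
            lintegral_tsum fun k => (hm k).aemeasurable]
          congr 2
          ext k
          rw [lintegral_const_mul _ (hw.indicator (hΩm k)), lintegral_indicator (hΩm k)]

lemma decay {n : ℕ} {p : (Fin n → ℝ) → ℝ} (hp1 : ∀ x, 1 ≤ p x) {B : ℝ} (hB1 : 1 ≤ B)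
    (hB : ∀ᵐ x ∂(volume : Measure (Fin n → ℝ)), p x ≤ B) {lam lam' C : ℝ} (hC : 0 < C)
    (hlam : 0 < lam) (hl : lam < lam')
    (hA : AInftyWith p lam C) :
    ∃ η : ℝ≥0∞, η ≠ 0 ∧ η < 1 ∧ ∀ F : ℕ → Set (RCube n),
      (∀ k, (F k).PairwiseDisjoint RCube.half) →
      (∀ k, (⋃ P ∈ F (k + 1), P.half) ⊆ ⋃ P ∈ F k, P.half) →
      ∀ τ : (Fin n → ℝ) → ℝ, (∀ x, 0 ≤ τ x) →
      (∀ k, ∀ Q ∈ F k, ∀ x ∈ Q.half, τ x = τ Q.center) →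
      (∀ k, ∀ Q ∈ F k, ENNReal.ofReal lam' * volume Q.half ≤
        volume (Q.half ∩ (⋃ P ∈ F (k + 1), P.half)ᶜ)) →
      ∫⁻ x in ⋃ P ∈ F 0, P.half, ENNReal.ofReal (τ x) ^ p x ≤ 1 →
      ∀ k, ∫⁻ x in ⋃ P ∈ F k, P.half, ENNReal.ofReal (τ x) ^ p x ≤ η ^ k := by
  obtain ⟨c, hc0, hc⟩ := gap_half hp1 hB hC hlam hl hA
  set d : ℝ≥0∞ := max (1 / 2) (1 - c) with hd
  have hd0 : d ≠ 0 := (lt_of_lt_of_le (by simp) (le_max_left _ _)).ne'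
  have hd1 : d < 1 := by
    refine max_lt (by simp) ?_
    exact ENNReal.sub_lt_self ENNReal.one_ne_top one_ne_zero hc0
  have hdt : d ≠ ∞ := (hd1.trans ENNReal.one_lt_top).ne
  set η : ℝ≥0∞ := d ^ (1 / B) with hη
  have hη1 : η < 1 := ENNReal.rpow_lt_one hd1 (by positivity)
  have hη0 : η ≠ 0 := by
    simp [hη, ENNReal.rpow_eq_zero_iff, hd0, hdt]
  have hηt : η ≠ ∞ := (hη1.trans ENNReal.one_lt_top).ne
  have hηB : η ^ B = d := by
    rw [hη, ← ENNReal.rpow_mul, one_div_mul_cancel (by linarith), ENNReal.rpow_one]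
  refine ⟨η, hη0, hη1, ?_⟩
  intro F hF hmono τ hτ0 hτ hvol h0
  set Ω : ℕ → Set (Fin n → ℝ) := fun k => ⋃ P ∈ F k, P.half with hΩ
  have hΩm : ∀ k, MeasurableSet (Ω k) := fun k =>
    MeasurableSet.biUnion (RCube.countable_of_half _ (hF k)) fun P _ => P.measurableSet_half
  have hηr : 0 < η.toReal := ENNReal.toReal_pos hη0 hηt
  have hconv : ∀ k x, ENNReal.ofReal (τ x / η.toReal ^ k) = ENNReal.ofReal (τ x) / η ^ k := by
    intro k x
    rw [ENNReal.ofReal_div_of_pos (by positivity), ENNReal.ofReal_pow hηr.le,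
      ENNReal.ofReal_toReal hηt]
  have main : ∀ k, ∫⁻ x in Ω k, (ENNReal.ofReal (τ x) / η ^ k) ^ p x ≤ 1 := by
    intro k
    induction k with
    | zero => simpa using h0
    | succ k ih =>
      have hJ : ∫⁻ x in Ω (k + 1), (ENNReal.ofReal (τ x) / η ^ k) ^ p x ≤ d := by
        by_cases hhalf : ∫⁻ x in Ω (k + 1), (ENNReal.ofReal (τ x) / η ^ k) ^ p x ≤ 1 / 2
        · exact hhalf.trans (le_max_left _ _)
        · push Not at hhalf
          have hI := hhalf.trans_le (lintegral_mono_set (hmono k))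
          have key := hc (F k) (hF k) (fun x => τ x / η.toReal ^ k)
            (fun x => div_nonneg (hτ0 x) (by positivity))
            (fun Q hQ x hx => by simp only [hτ k Q hQ x hx])
            (Ω (k + 1))ᶜ (hΩm _).compl (hvol k)
          simp only [hconv] at key
          have key2 := key hI
          refine le_trans ?_ (le_max_right _ _)
          have hsplit := lintegral_inter_add_sdiff
            (μ := volume) (fun x => (ENNReal.ofReal (τ x) / η ^ k) ^ p x) (Ω k) (hΩm (k + 1))
          rw [Set.inter_eq_self_of_subset_right (hmono k), Set.sdiff_eq] at hsplit
          have hct : c ≠ ∞ := by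
            refine ne_top_of_le_ne_top ENNReal.one_ne_top (key2.trans (le_trans ?_ ih))
            exact lintegral_mono_set Set.inter_subset_left
          refine ENNReal.le_sub_of_add_le_right hct ?_
          refine le_trans ?_ ih
          rw [← hsplit]
          gcongr
      calc ∫⁻ x in Ω (k + 1), (ENNReal.ofReal (τ x) / η ^ (k + 1)) ^ p x
          ≤ ∫⁻ x in Ω (k + 1), (η ^ B)⁻¹ * (ENNReal.ofReal (τ x) / η ^ k) ^ p x := by
            refine lintegral_mono_ae ?_
            filter_upwards [ae_restrict_of_ae hB] with x hx
            refine le_trans (le_of_eq ?_) (rpow_div_le hη0 hη1.le (hp1 x) hx)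
            congr 1
            rw [pow_succ, div_eq_mul_inv, div_eq_mul_inv, div_eq_mul_inv,
              ENNReal.mul_inv (Or.inr hηt) (Or.inr hη0), mul_assoc]
        _ = (η ^ B)⁻¹ * ∫⁻ x in Ω (k + 1), (ENNReal.ofReal (τ x) / η ^ k) ^ p x :=
            lintegral_const_mul' _ _ (by rw [hηB]; simpa using hd0)
        _ ≤ d⁻¹ * d := by rw [hηB]; gcongr
        _ = 1 := ENNReal.inv_mul_cancel hd0 hdt
  intro k
  have hk0 : η ^ k ≠ 0 := pow_ne_zero _ hη0
  have hkt : η ^ k ≠ ∞ := ENNReal.pow_ne_top hηt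
  calc ∫⁻ x in Ω k, ENNReal.ofReal (τ x) ^ p x
      ≤ ∫⁻ x in Ω k, η ^ k * (ENNReal.ofReal (τ x) / η ^ k) ^ p x := by
        refine lintegral_mono fun x => ?_
        refine le_trans (le_of_eq ?_) (rpow_mul_le' (pow_le_one₀ zero_le hη1.le) (hp1 x))
        rw [ENNReal.mul_div_cancel hk0 hkt]
    _ = η ^ k * ∫⁻ x in Ω k, (ENNReal.ofReal (τ x) / η ^ k) ^ p x :=
        lintegral_const_mul' _ _ hkt
    _ ≤ η ^ k * 1 := by gcongr; exact main k
    _ = η ^ k := mul_one _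

lemma exists_eps {a η : ℝ≥0∞} (hat : a ≠ ∞) (hη1 : η < 1) :
    ∃ ε : ℝ, 0 < ε ∧ a ^ ε * η < 1 := by
  have h1 := (ENNReal.tendsto_pow_atTop_nhds_zero_of_lt_one hη1)
  have h2 : ∀ᶠ N : ℕ in Filter.atTop, η ^ N < a⁻¹ :=
    h1.eventually_lt_const (by simpa using hat)
  obtain ⟨N, hN, hN1⟩ := (h2.and (Filter.eventually_ge_atTop 1)).exists
  have hNr : (0 : ℝ) < N := by exact_mod_cast hN1
  refine ⟨1 / N, by positivity, ?_⟩
  have h3 : a * η ^ N < 1 := by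
    by_cases ha : a = 0
    · simp [ha]
    · calc a * η ^ N < a * a⁻¹ := (ENNReal.mul_lt_mul_iff_right ha hat).2 hN
        _ = 1 := ENNReal.mul_inv_cancel ha hat
  have h4 := ENNReal.rpow_lt_one h3 (show (0 : ℝ) < 1 / N by positivity)
  rwa [ENNReal.mul_rpow_of_nonneg _ _ (by positivity), ← ENNReal.rpow_natCast, ← ENNReal.rpow_mul,
    mul_one_div_cancel hNr.ne', ENNReal.rpow_one] at h4

lemma complement_vol {n : ℕ} {lam : ℝ} (h0 : 0 < lam) (h1 : lam < 1) (R : RCube n)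
    (W : Set (Fin n → ℝ)) (hW : MeasurableSet W)
    (h : ENNReal.ofReal (2 / (1 - lam)) * volume (R.half ∩ W) ≤ volume R.half) :
    ENNReal.ofReal ((1 + lam) / 2) * volume R.half ≤ volume (R.half ∩ Wᶜ) := by
  have hl : 0 < 1 - lam := by linarith
  have e1 : volume (R.half ∩ W) ≤ ENNReal.ofReal ((1 - lam) / 2) * volume R.half := by
    calc volume (R.half ∩ W) = ENNReal.ofReal ((1 - lam) / 2) *
          (ENNReal.ofReal (2 / (1 - lam)) * volume (R.half ∩ W)) := by
            rw [← mul_assoc, ← ENNReal.ofReal_mul (by linarith),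
              show (1 - lam) / 2 * (2 / (1 - lam)) = 1 by field_simp]
            simp
      _ ≤ _ := by gcongr
  have e2 := measure_inter_add_sdiff (μ := volume) R.half hW
  rw [Set.sdiff_eq] at e2
  have hft : ENNReal.ofReal ((1 - lam) / 2) * volume R.half ≠ ∞ :=
    ENNReal.mul_ne_top ENNReal.ofReal_ne_top R.volume_half_ne_top
  refine (ENNReal.add_le_add_iff_right hft).1 ?_
  calc ENNReal.ofReal ((1 + lam) / 2) * volume R.half +
        ENNReal.ofReal ((1 - lam) / 2) * volume R.half = volume R.half := by
          rw [← add_mul, ← ENNReal.ofReal_add (by linarith) (by linarith),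
            show (1 + lam) / 2 + (1 - lam) / 2 = 1 by ring]
          simp
    _ = volume (R.half ∩ W) + volume (R.half ∩ Wᶜ) := e2.symm
    _ ≤ ENNReal.ofReal ((1 - lam) / 2) * volume R.half + volume (R.half ∩ Wᶜ) := by gcongr
    _ = _ := add_comm _ _

theorem statement12 {n : ℕ} (p : (Fin n → ℝ) → ℝ) (hpm : Measurable p)
    (hp1 : ∀ x, 1 ≤ p x)
    (hup : ∃ B : ℝ, ∀ᵐ x ∂(volume : Measure (Fin n → ℝ)), p x ≤ B)
    (hA : AInfty p) : RHCond p := by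
  classical
  obtain ⟨B0, hB0⟩ := hup
  obtain ⟨lam, ⟨hl0, hl1⟩, C, hC, hA⟩ := hA
  have hB : ∀ᵐ x ∂(volume : Measure (Fin n → ℝ)), p x ≤ max B0 1 :=
    hB0.mono fun x hx => hx.trans (le_max_left _ _)
  obtain ⟨η, hη0, hη1, hdecay⟩ := decay (lam' := (1 + lam) / 2) hp1 (le_max_right B0 1) hB hC hl0
    (by linarith) hA
  have hl : 0 < 1 - lam := by linarith
  set b : ℝ≥0∞ := ENNReal.ofReal (2 / (1 - lam)) with hb
  have hb1 : 1 ≤ b := by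
    rw [hb, ENNReal.one_le_ofReal, le_div_iff₀ hl]; linarith
  have hbt : b ≠ ∞ := ENNReal.ofReal_ne_top
  set a : ℝ≥0∞ := 2 ^ n * b with ha
  have hat : a ≠ ∞ := ENNReal.mul_ne_top (by simp) hbt
  obtain ⟨ε, hε, haε⟩ := exists_eps hat hη1
  set K : ℝ≥0∞ := 1 + a ^ ε * (1 - a ^ ε * η)⁻¹ with hK
  have hKt : K ≠ ∞ := by
    refine ENNReal.add_ne_top.2 ⟨ENNReal.one_ne_top, ENNReal.mul_ne_top ?_ ?_⟩
    · exact ENNReal.rpow_ne_top_of_nonneg hε.le hat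
    · rw [ENNReal.inv_ne_top]; exact (tsub_pos_of_lt haε).ne'
  have hK0 : 0 < K := lt_of_lt_of_le one_pos le_self_add
  refine ⟨1 + ε, by linarith, K.toReal, ENNReal.toReal_pos hK0.ne' hKt, ?_⟩
  intro S hS t ht hsum
  rw [ENNReal.ofReal_toReal hKt]
  set w : RCube n → (Fin n → ℝ) → ℝ≥0∞ := fun Q x => ENNReal.ofReal (t Q) ^ p x with hw
  have hwm : ∀ Q, Measurable (w Q) := fun Q => Measurable.pow measurable_const hpm
  have hsum' : ∑' Q : S, ∫⁻ x in Q.1.half, w Q.1 x ≤ 1 := by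
    refine le_trans (le_of_eq ?_) hsum
    congr 1; ext Q
    exact setLIntegral_congr Q.1.half_ae
  have hSd : S.PairwiseDisjoint RCube.half := fun Q hQ R hR hne =>
    (hS hQ hR hne).mono Q.half_subset R.half_subset
  have hSc := RCube.countable_of_half S hSd
  have hex : ∀ Q : RCube n, ∃ F : ℕ → Set (RCube n), Q ∈ S → (F 0 = {Q} ∧
      (∀ k, (F k).PairwiseDisjoint RCube.half) ∧
      (∀ k, (⋃ P ∈ F (k + 1), P.half) ⊆ ⋃ P ∈ F k, P.half) ∧
      (∀ k, ∀ R ∈ F k, b * volume (R.half ∩ ⋃ P ∈ F (k + 1), P.half) ≤ volume R.half) ∧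
      volume Q.half * ((∫⁻ x in Q.half, w Q x ^ (1 + ε)) / volume Q.half) ^ (1 / (1 + ε)) ≤
        (∫⁻ x in Q.half, w Q x) + ∑' k : ℕ, (a ^ (k + 1)) ^ ε *
          ∫⁻ x in ⋃ P ∈ F k, P.half, w Q x) := by
    intro Q
    by_cases hQ : Q ∈ S
    · have hfin : ∫⁻ x in Q.half, w Q x ≠ ∞ := by
        refine ne_top_of_le_ne_top ENNReal.one_ne_top (le_trans ?_ hsum')
        exact ENNReal.le_tsum (f := fun Q : S => ∫⁻ x in Q.1.half, w Q.1 x) ⟨Q, hQ⟩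
      obtain ⟨F, hF⟩ := cz_rh (w Q) (hwm Q) b hb1 hbt hε Q hfin
      exact ⟨F, fun _ => hF⟩
    · exact ⟨fun _ => ∅, fun h => absurd h hQ⟩
  choose F hF using hex
  set τ : (Fin n → ℝ) → ℝ := fun x =>
    if h : ∃ Q ∈ S, x ∈ Q.half then t h.choose else 0 with hτ
  have hτQ : ∀ Q ∈ S, ∀ x ∈ Q.half, τ x = t Q := by
    intro Q hQ x hx
    have h : ∃ Q ∈ S, x ∈ Q.half := ⟨Q, hQ, hx⟩
    simp only [hτ, dif_pos h]
    congr 1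
    by_contra hne
    exact Set.disjoint_left.1 (hSd h.choose_spec.1 hQ hne) h.choose_spec.2 hx
  have hτ0 : ∀ x, 0 ≤ τ x := by
    intro x
    simp only [hτ]
    split_ifs with h
    · exact ht _ h.choose_spec.1
    · exact le_rfl
  -- cubes of generation `k` inside `Q`
  have hsub : ∀ Q ∈ S, ∀ k, (⋃ P ∈ F Q k, P.half) ⊆ Q.half := by
    intro Q hQ k
    induction k with
    | zero => rw [(hF Q hQ).1]; simp
    | succ k ih => exact ((hF Q hQ).2.2.1 k).trans ih
  have hsub' : ∀ Q ∈ S, ∀ k, ∀ P ∈ F Q k, P.half ⊆ Q.half := fun Q hQ k P hP =>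
    (Set.subset_biUnion_of_mem (u := fun R : RCube n => R.half) hP).trans (hsub Q hQ k)
  set Φ : ℕ → Set (RCube n) := fun k => ⋃ Q ∈ S, F Q k with hΦ
  have hΦU : ∀ k, (⋃ P ∈ Φ k, P.half) = ⋃ Q ∈ S, ⋃ P ∈ F Q k, P.half := by
    intro k
    ext x
    simp only [hΦ, Set.mem_iUnion, exists_prop]
    constructor
    · rintro ⟨P, ⟨Q, hQ, hP⟩, hx⟩; exact ⟨Q, hQ, P, hP, hx⟩
    · rintro ⟨Q, hQ, P, hP, hx⟩; exact ⟨P, ⟨Q, hQ, hP⟩, hx⟩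
  have hΦd : ∀ k, (Φ k).PairwiseDisjoint RCube.half := by
    intro k P hP P' hP' hne
    obtain ⟨R, hR, hPR⟩ := Set.mem_iUnion₂.1 hP
    obtain ⟨R', hR', hPR'⟩ := Set.mem_iUnion₂.1 hP'
    by_cases hRR : R = R'
    · subst hRR
      exact (hF R hR).2.1 k hPR hPR' hne
    · exact (hSd hR hR' hRR).mono (hsub' R hR k P hPR) (hsub' R' hR' k P' hPR')
  have hm : ∀ Q ∈ S, ∀ k, MeasurableSet (⋃ P ∈ F Q k, P.half) := fun Q hQ k =>
    MeasurableSet.biUnion (RCube.countable_of_half _ ((hF Q hQ).2.1 k))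
      fun P _ => P.measurableSet_half
  have hint : ∀ k, ∫⁻ x in ⋃ P ∈ Φ k, P.half, ENNReal.ofReal (τ x) ^ p x =
      ∑' Q : S, ∫⁻ x in ⋃ P ∈ F Q.1 k, P.half, w Q.1 x := by
    intro k
    rw [hΦU, lintegral_biUnion hSc (fun Q hQ => hm Q hQ k)
      (fun Q hQ R hR hne => (hSd hQ hR hne).mono (hsub Q hQ k) (hsub R hR k))]
    congr 1; ext Q
    refine setLIntegral_congr_fun (hm Q.1 Q.2 k) fun x hx => ?_
    simp only [hw]
    rw [hτQ Q.1 Q.2 x (hsub Q.1 Q.2 k hx)]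
  have hdec := hdecay Φ hΦd (by
      intro k
      rw [hΦU, hΦU]
      exact Set.iUnion₂_mono fun Q hQ => (hF Q hQ).2.2.1 k) τ hτ0 (by
      intro k P hP x hx
      obtain ⟨Q, hQ, hPQ⟩ := Set.mem_iUnion₂.1 hP
      rw [hτQ Q hQ x (hsub' Q hQ k P hPQ hx), hτQ Q hQ _ (hsub' Q hQ k P hPQ P.center_mem)]) (by
      intro k P hP
      refine complement_vol hl0 hl1 P _ ?_ ?_
      · exact MeasurableSet.biUnion (RCube.countable_of_half _ (hΦd (k + 1)))
          fun P _ => P.measurableSet_half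
      obtain ⟨Q, hQ, hPQ⟩ := Set.mem_iUnion₂.1 hP
      refine le_trans ?_ ((hF Q hQ).2.2.2.1 k P hPQ)
      refine mul_le_mul_right (measure_mono ?_) _
      rintro x ⟨hxP, hx⟩
      refine ⟨hxP, ?_⟩
      rw [hΦU] at hx
      obtain ⟨Q', hQ', hx'⟩ := Set.mem_iUnion₂.1 hx
      have : Q = Q' := by
        by_contra hne
        exact Set.disjoint_left.1 (hSd hQ hQ' hne) (hsub' Q hQ k P hPQ hxP)
          (hsub Q' hQ' _ hx')
      subst this
      exact hx') (by
      rw [hint]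
      refine le_trans (le_of_eq ?_) hsum'
      congr 1; ext Q
      rw [(hF Q.1 Q.2).1]; simp)
  calc ∑' Q : S, volume Q.1.toSet *
            ((∫⁻ x in Q.1.toSet, ENNReal.ofReal (t Q.1) ^ ((1 + ε) * p x)) / volume Q.1.toSet)
              ^ (1 / (1 + ε))
      ≤ ∑' Q : S, ((∫⁻ x in Q.1.half, w Q.1 x) + ∑' k : ℕ, (a ^ (k + 1)) ^ ε *
          ∫⁻ x in ⋃ P ∈ F Q.1 k, P.half, w Q.1 x) := by
        refine ENNReal.tsum_le_tsum fun Q => ?_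
        refine le_trans (le_of_eq ?_) (hF Q.1 Q.2).2.2.2.2
        rw [setLIntegral_congr Q.1.half_ae.symm, measure_congr Q.1.half_ae.symm]
        congr 4
        ext x
        rw [mul_comm, ENNReal.rpow_mul]
    _ = (∑' Q : S, ∫⁻ x in Q.1.half, w Q.1 x) + ∑' k : ℕ, (a ^ (k + 1)) ^ ε *
          ∑' Q : S, ∫⁻ x in ⋃ P ∈ F Q.1 k, P.half, w Q.1 x := by
        rw [ENNReal.tsum_add, ENNReal.tsum_comm]
        congr 2
        ext k
        rw [ENNReal.tsum_mul_left]
    _ ≤ 1 + ∑' k : ℕ, a ^ ε * (a ^ ε * η) ^ k := by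
        refine add_le_add hsum' (ENNReal.tsum_le_tsum fun k => ?_)
        rw [← hint k]
        calc (a ^ (k + 1)) ^ ε * ∫⁻ x in ⋃ P ∈ Φ k, P.half, ENNReal.ofReal (τ x) ^ p x
            ≤ (a ^ (k + 1)) ^ ε * η ^ k := by gcongr; exact hdec k
          _ = a ^ ε * (a ^ ε * η) ^ k := by
            rw [← ENNReal.rpow_natCast a, ← ENNReal.rpow_mul, mul_comm _ ε, ENNReal.rpow_mul,
              ENNReal.rpow_natCast, pow_succ, mul_pow]
            ring
    _ = K := by rw [ENNReal.tsum_mul_left, ENNReal.tsum_geometric]
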